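/- Let L = F_q with q = 2^n and let f(x) = x^{2^{2k}−2^k+1} + g(x) ∈ L[x], where g(x) = Σ_{j=0}^{2^{2k-1}−2^{k-1}+1} a_j x^j has degree at most 2^{2k-1}−2^{k-1}+1. Suppose there exists an index j ≥ 3 with a_j ≠ 0 such that φ_j(x,y,z) is absolutely irreducible. Then φ(x,y,z) is absolutely irreducible. -/

import Mathlib

open MvPolynomial

/-- The polynomial `(x+y)(x+z)(y+z)` in `L[x,y,z]` (variables `X 0, X 1, X 2`). -/
noncomputable def delta3 (L : Type) [CommRing L] : MvPolynomial (Fin 3) L :=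
  (X 0 + X 1) * (X 0 + X 2) * (X 1 + X 2)

/-- The numerator `f(x) + f(y) + f(z) + f(x+y+z)` of `φ`, as an element of `L[x,y,z]`. -/
noncomputable def phiNum {L : Type} [CommRing L] (f : Polynomial L) :
    MvPolynomial (Fin 3) L :=
  Polynomial.aeval (X 0 : MvPolynomial (Fin 3) L) f +
    Polynomial.aeval (X 1 : MvPolynomial (Fin 3) L) f +
    Polynomial.aeval (X 2 : MvPolynomial (Fin 3) L) f +
    Polynomial.aeval (X 0 + X 1 + X 2 : MvPolynomial (Fin 3) L) f

/-- The numerator `x^j + y^j + z^j + (x+y+z)^j` of `φ_j`, as an element of `L[x,y,z]`. -/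
noncomputable def phiJNum (L : Type) [CommRing L] (j : ℕ) : MvPolynomial (Fin 3) L :=
  X 0 ^ j + X 1 ^ j + X 2 ^ j + (X 0 + X 1 + X 2) ^ j

/-- A polynomial over a field `L` is absolutely irreducible if it is irreducible over
the algebraic closure of `L`. -/
def AbsolutelyIrreducible {L : Type} [Field L] (p : MvPolynomial (Fin 3) L) : Prop :=
  Irreducible (MvPolynomial.map (algebraMap L (AlgebraicClosure L)) p)

namespace MvPolynomial

variable {σ R : Type*}

lemma homogeneousComponent_add_mul_of_isHomogeneous [CommSemiring R] {A : MvPolynomial σ R}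
    {m : ℕ} (hA : A.IsHomogeneous m) (B : MvPolynomial σ R) (n : ℕ) :
    homogeneousComponent (m + n) (A * B) = A * homogeneousComponent n B := by
  conv_lhs => rw [← sum_homogeneousComponent B, Finset.mul_sum, map_sum]
  have key (i : ℕ) : homogeneousComponent (m + n) (A * homogeneousComponent i B) =
      if n = i then A * homogeneousComponent i B else 0 := by
    rw [homogeneousComponent_of_mem ((mem_homogeneousSubmodule _ _).mpr
      (hA.mul (homogeneousComponent_isHomogeneous i B)))]
    simp only [Nat.add_left_cancel_iff]
  rw [Finset.sum_congr rfl fun i _ => key i, Finset.sum_ite_eq]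
  split_ifs with h
  · rfl
  · rw [homogeneousComponent_eq_zero _ _ (by rw [Finset.mem_range] at h; omega), mul_zero]

lemma homogeneousComponent_mul_eq_zero_of_isHomogeneous [CommSemiring R] {A : MvPolynomial σ R}
    {m : ℕ} (hA : A.IsHomogeneous m) (B : MvPolynomial σ R) {n : ℕ} (hn : n < m) :
    homogeneousComponent n (A * B) = 0 := by
  conv_lhs => rw [← sum_homogeneousComponent B, Finset.mul_sum, map_sum]
  refine Finset.sum_eq_zero fun i _ => ?_
  rw [homogeneousComponent_of_mem ((mem_homogeneousSubmodule _ _).mpr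
      (hA.mul (homogeneousComponent_isHomogeneous i B))), if_neg (by omega)]

lemma IsHomogeneous.dvd_homogeneousComponent [CommSemiring R] {A B : MvPolynomial σ R} {m : ℕ}
    (hA : A.IsHomogeneous m) (h : A ∣ B) (n : ℕ) : A ∣ homogeneousComponent n B := by
  obtain ⟨C, rfl⟩ := h
  rcases lt_or_ge n m with hn | hn
  · rw [homogeneousComponent_mul_eq_zero_of_isHomogeneous hA _ hn]
    exact dvd_zero _
  · obtain ⟨r, rfl⟩ := Nat.exists_eq_add_of_le hn
    rw [homogeneousComponent_add_mul_of_isHomogeneous hA]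
    exact dvd_mul_right _ _

lemma homogeneousComponent_totalDegree_ne_zero [CommSemiring R] {A : MvPolynomial σ R}
    (hA : A ≠ 0) : homogeneousComponent A.totalDegree A ≠ 0 := by
  obtain ⟨d, hd, h⟩ := Finset.exists_mem_eq_sup A.support (support_nonempty.mpr hA)
    (fun s => s.sum fun _ e => e)
  intro h0
  have hc := congrArg (coeff d) h0
  rw [coeff_homogeneousComponent, if_pos, coeff_zero] at hc
  · exact mem_support_iff.mp hd hc
  · rw [totalDegree, h, Finsupp.degree_apply]; rfl

lemma exists_eq_homogeneousComponent_totalDegree_add [CommSemiring R] (A : MvPolynomial σ R)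
    (hA : 0 < A.totalDegree) : ∃ B : MvPolynomial σ R, B.totalDegree < A.totalDegree ∧
      A = homogeneousComponent A.totalDegree A + B := by
  refine ⟨∑ i ∈ Finset.range A.totalDegree, homogeneousComponent i A, ?_, ?_⟩
  · refine lt_of_le_of_lt (totalDegree_finsetSum_le (d := A.totalDegree - 1) fun i hi => ?_)
      (Nat.sub_lt hA one_pos)
    have := (homogeneousComponent_isHomogeneous i A).totalDegree_le
    have := Finset.mem_range.mp hi
    omega
  · conv_lhs => rw [← sum_homogeneousComponent A, Finset.sum_range_succ, add_comm]

lemma homogeneousComponent_totalDegree_mul [CommSemiring R] (A B : MvPolynomial σ R) :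
    homogeneousComponent (A.totalDegree + B.totalDegree) (A * B) =
      homogeneousComponent A.totalDegree A * homogeneousComponent B.totalDegree B := by
  rcases Nat.eq_zero_or_pos A.totalDegree with hA | hA
  · have h0 := (totalDegree_zero_iff_isHomogeneous σ).mp hA
    rw [hA, homogeneousComponent_add_mul_of_isHomogeneous h0, homogeneousComponent_eq_self h0]
  · obtain ⟨A', hA', h⟩ := exists_eq_homogeneousComponent_totalDegree_add A hA
    have hs : homogeneousComponent (A.totalDegree + B.totalDegree) (A * B) =
        homogeneousComponent (A.totalDegree + B.totalDegree)
          (homogeneousComponent A.totalDegree A * B + A' * B) := by rw [← add_mul, ← h]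
    rw [hs, map_add, homogeneousComponent_add_mul_of_isHomogeneous
      (homogeneousComponent_isHomogeneous _ _), homogeneousComponent_eq_zero _ (A' * B), add_zero]
    exact lt_of_le_of_lt (totalDegree_mul _ _) (by omega)

/-- If the components of `P * Q` strictly between the top degree and `deg P ≥ deg Q` vanish and
the leading forms of `P` and `Q` are coprime, then `Q` is homogeneous. -/
lemma isHomogeneous_of_homogeneousComponent_mul_eq_zero [CommRing R] [IsDomain R]
    [UniqueFactorizationMonoid R] {P Q : MvPolynomial σ R} (hQ : 0 < Q.totalDegree)
    (hle : Q.totalDegree ≤ P.totalDegree)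
    (hcop : IsRelPrime (homogeneousComponent P.totalDegree P)
      (homogeneousComponent Q.totalDegree Q))
    (hgap : ∀ r, P.totalDegree ≤ r → r < P.totalDegree + Q.totalDegree →
      homogeneousComponent r (P * Q) = 0) :
    Q.IsHomogeneous Q.totalDegree := by
  obtain ⟨P', hP', hPe⟩ := exists_eq_homogeneousComponent_totalDegree_add P (hQ.trans_le hle)
  obtain ⟨Q', hQ', hQe⟩ := exists_eq_homogeneousComponent_totalDegree_add Q hQ
  have hPs := homogeneousComponent_isHomogeneous P.totalDegree P
  have hQt := homogeneousComponent_isHomogeneous Q.totalDegree Q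
  have hQt0 : homogeneousComponent Q.totalDegree Q ≠ 0 :=
    homogeneousComponent_totalDegree_ne_zero (by rintro rfl; simp at hQ)
  have hPs0 : homogeneousComponent P.totalDegree P ≠ 0 :=
    homogeneousComponent_totalDegree_ne_zero (by rintro rfl; simp at hP')
  generalize P.totalDegree = s at *
  generalize Q.totalDegree = t at *
  generalize homogeneousComponent s P = p at *
  generalize homogeneousComponent t Q = q at *
  have hrel (a b : ℕ) (hab : s + a = t + b) (ha : a < t) (hd : P'.totalDegree ≤ b)
      (hd' : Q'.totalDegree ≤ a) :
      homogeneousComponent a Q' = 0 ∧ homogeneousComponent b P' = 0 := by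
    have h := hgap (s + a) (by omega) (by omega)
    have hexp : P * Q = p * q + p * Q' + q * P' + P' * Q' := by rw [hPe, hQe]; ring
    rw [hexp, map_add, map_add, map_add,
      homogeneousComponent_of_mem ((mem_homogeneousSubmodule _ _).mpr (hPs.mul hQt)),
      if_neg (by omega), homogeneousComponent_add_mul_of_isHomogeneous hPs, hab,
      homogeneousComponent_add_mul_of_isHomogeneous hQt,
      homogeneousComponent_eq_zero _ (P' * Q')
        (lt_of_le_of_lt (totalDegree_mul _ _) (by omega)), zero_add, add_zero] at h
    have hdvd : q ∣ p * homogeneousComponent a Q' :=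
      ⟨-homogeneousComponent b P', by linear_combination h⟩
    have hz : homogeneousComponent a Q' = 0 := by
      by_contra hne
      obtain ⟨e, he⟩ := hcop.symm.dvd_of_dvd_mul_left hdvd
      have h1 := (homogeneousComponent_isHomogeneous a Q').totalDegree hne
      have he0 : e ≠ 0 := by rintro rfl; simp [he] at hne
      rw [he, totalDegree_mul_of_isDomain hQt0 he0, hQt.totalDegree hQt0] at h1
      omega
    rw [hz, mul_zero, zero_add] at h
    exact ⟨hz, (mul_eq_zero.mp h).resolve_left hQt0⟩
  have hQ0 : Q' = 0 := by
    by_contra hne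
    rcases le_or_gt (t + P'.totalDegree) (s + Q'.totalDegree) with hc | hc
    · exact homogeneousComponent_totalDegree_ne_zero hne
        (hrel Q'.totalDegree (s + Q'.totalDegree - t) (by omega) hQ' (by omega) le_rfl).1
    · have hP0 : P' ≠ 0 := by rintro rfl; simp at hc; omega
      exact homogeneousComponent_totalDegree_ne_zero hP0
        (hrel (t + P'.totalDegree - s) P'.totalDegree (by omega) (by omega) le_rfl (by omega)).2
  rw [hQe, hQ0, add_zero]
  exact hQt

end MvPolynomial

/-- In characteristic two, four coordinates with `∑ uᵢ^(q+1) = ∑ uᵢ^(q³+1) = 0` lie on an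
`𝔽_{q²}`-rational line of the Hermitian surface, so the first three satisfy a linear relation
whose coefficients form a point of the Hermitian curve. -/
lemma exists_hermitian_relation {Ω : Type*} [Field Ω] [IsAlgClosed Ω] [CharP Ω 2] {q : ℕ}
    (hq : 1 < q) (F : Ω →+* Ω) (hF : ∀ x, F x = x ^ q) {u₁ u₂ u₃ u₄ : Ω}
    (h₁ : u₁ * F u₁ + u₂ * F u₂ + u₃ * F u₃ + u₄ * F u₄ = 0)
    (h₃ : u₁ * F (F (F u₁)) + u₂ * F (F (F u₂)) + u₃ * F (F (F u₃)) + u₄ * F (F (F u₄)) = 0)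
    (hne : u₁ * F (F u₂) - u₂ * F (F u₁) ≠ 0 ∨ u₁ * F (F u₃) - u₃ * F (F u₁) ≠ 0 ∨
      u₂ * F (F u₃) - u₃ * F (F u₂) ≠ 0) :
    ∃ a₁ a₂ a₃ : Ω, (a₁ ≠ 0 ∨ a₂ ≠ 0 ∨ a₃ ≠ 0) ∧
      F (F a₁) = a₁ ∧ F (F a₂) = a₂ ∧ F (F a₃) = a₃ ∧
      a₁ * F a₁ + a₂ * F a₂ + a₃ * F a₃ = 0 ∧ a₁ * u₁ + a₂ * u₂ + a₃ * u₃ = 0 := by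
  have h2 : (2 : Ω) = 0 := CharTwo.two_eq_zero
  have h₁' := congrArg F h₁
  have h₁'' := congrArg F h₁'
  simp only [map_add, map_mul, map_zero] at h₁' h₁''
  obtain ⟨a₁, ha₁⟩ : ∃ a, a = u₂ * F (F u₃) - u₃ * F (F u₂) := ⟨_, rfl⟩
  obtain ⟨a₂, ha₂⟩ : ∃ a, a = u₁ * F (F u₃) - u₃ * F (F u₁) := ⟨_, rfl⟩
  obtain ⟨a₃, ha₃⟩ : ∃ a, a = u₁ * F (F u₂) - u₂ * F (F u₁) := ⟨_, rfl⟩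
  obtain ⟨b₁, hb₁⟩ : ∃ b, b = u₁ * F (F u₄) - u₄ * F (F u₁) := ⟨_, rfl⟩
  obtain ⟨b₂, hb₂⟩ : ∃ b, b = u₂ * F (F u₄) - u₄ * F (F u₂) := ⟨_, rfl⟩
  obtain ⟨b₃, hb₃⟩ : ∃ b, b = u₃ * F (F u₄) - u₄ * F (F u₃) := ⟨_, rfl⟩
  have hFa₁ : F a₁ = F u₂ * F (F (F u₃)) - F u₃ * F (F (F u₂)) := by simp [ha₁]
  have hFa₂ : F a₂ = F u₁ * F (F (F u₃)) - F u₃ * F (F (F u₁)) := by simp [ha₂]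
  have hFa₃ : F a₃ = F u₁ * F (F (F u₂)) - F u₂ * F (F (F u₁)) := by simp [ha₃]
  have hFb₁ : F b₁ = F u₁ * F (F (F u₄)) - F u₄ * F (F (F u₁)) := by simp [hb₁]
  have hFb₂ : F b₂ = F u₂ * F (F (F u₄)) - F u₄ * F (F (F u₂)) := by simp [hb₂]
  have hFb₃ : F b₃ = F u₃ * F (F (F u₄)) - F u₄ * F (F (F u₃)) := by simp [hb₃]
  rw [← ha₁, ← ha₂, ← ha₃] at hne
  have hau : a₁ * u₁ + a₂ * u₂ + a₃ * u₃ = 0 := by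
    rw [ha₁, ha₂, ha₃]
    linear_combination (u₁ * u₂ * F (F u₃) - u₂ * u₃ * F (F u₁)) * h2
  have hpl : a₁ * b₁ + a₂ * b₂ + a₃ * b₃ = 0 := by
    rw [ha₁, ha₂, ha₃, hb₁, hb₂, hb₃]
    linear_combination ((u₁ * F (F u₃) - u₃ * F (F u₁)) * (u₂ * F (F u₄) - u₄ * F (F u₂))) * h2
  generalize hv₁ : F (F u₁) = v₁ at *
  generalize hv₂ : F (F u₂) = v₂ at *
  generalize hv₃ : F (F u₃) = v₃ at *
  generalize hv₄ : F (F u₄) = v₄ at *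
  generalize F u₁ = x₁ at *
  generalize F u₂ = x₂ at *
  generalize F u₃ = x₃ at *
  generalize F u₄ = x₄ at *
  generalize F v₁ = y₁ at *
  generalize F v₂ = y₂ at *
  generalize F v₃ = y₃ at *
  generalize F v₄ = y₄ at *
  -- the Plücker coordinates of the two orthogonal planes are dual to each other
  have d₁ : a₁ * F a₁ = b₁ * F b₁ := by
    rw [hFa₁, hFb₁, ha₁, hb₁]
    linear_combination (u₂ * x₂ + u₃ * x₃) * h₁'' - (v₁ * y₁ + v₄ * y₄) * h₁ -
      (u₂ * y₂ + u₃ * y₃) * h₁' + (v₁ * x₁ + v₄ * x₄) * h₃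
  have d₂ : a₂ * F a₂ = b₂ * F b₂ := by
    rw [hFa₂, hFb₂, ha₂, hb₂]
    linear_combination (u₁ * x₁ + u₃ * x₃) * h₁'' - (v₂ * y₂ + v₄ * y₄) * h₁ -
      (u₁ * y₁ + u₃ * y₃) * h₁' + (v₂ * x₂ + v₄ * x₄) * h₃
  have d₃ : a₃ * F a₃ = b₃ * F b₃ := by
    rw [hFa₃, hFb₃, ha₃, hb₃]
    linear_combination (u₁ * x₁ + u₂ * x₂) * h₁'' - (v₃ * y₃ + v₄ * y₄) * h₁ -
      (u₁ * y₁ + u₂ * y₂) * h₁' + (v₃ * x₃ + v₄ * x₄) * h₃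
  have c₁₂ : b₁ * F a₂ = b₂ * F a₁ := by
    rw [← sub_eq_zero, CharTwo.sub_eq_add, hFa₁, hFa₂, hb₁, hb₂]
    linear_combination -(v₄ * (x₃ * h₃ - y₃ * h₁) - u₄ * (x₃ * h₁'' - y₃ * h₁'))
  have c₁₃ : b₁ * F a₃ = b₃ * F a₁ := by
    rw [hFa₁, hFa₃, hb₁, hb₃]
    linear_combination -(v₄ * (x₂ * h₃ - y₂ * h₁) - u₄ * (x₂ * h₁'' - y₂ * h₁'))
  have c₂₃ : b₂ * F a₃ = b₃ * F a₂ := by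
    rw [← sub_eq_zero, CharTwo.sub_eq_add, hFa₂, hFa₃, hb₂, hb₃]
    linear_combination (v₄ * (x₁ * h₃ - y₁ * h₁) - u₄ * (x₁ * h₁'' - y₁ * h₁'))
  have hF0 {x : Ω} (hx : x ≠ 0) : F x ≠ 0 := (map_ne_zero F).mpr hx
  obtain ⟨l, l₁, l₂, l₃⟩ : ∃ l, b₁ = l * F a₁ ∧ b₂ = l * F a₂ ∧ b₃ = l * F a₃ := by
    have quot {b c d e : Ω} (he : e ≠ 0) (h : b * F e = c * d) : b = c / F e * d := by
      rw [div_mul_eq_mul_div, eq_div_iff (hF0 he), h]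
    rcases hne with h | h | h
    · exact ⟨b₃ / F a₃, quot h c₁₃, quot h c₂₃, quot h rfl⟩
    · exact ⟨b₂ / F a₂, quot h c₁₂, quot h rfl, quot h c₂₃.symm⟩
    · exact ⟨b₁ / F a₁, quot h rfl, quot h c₁₂.symm, quot h c₁₃.symm⟩
  have hl : l ≠ 0 := by
    rintro rfl
    rw [l₁, zero_mul, zero_mul] at d₁
    rw [l₂, zero_mul, zero_mul] at d₂
    rw [l₃, zero_mul, zero_mul] at d₃
    simp only [mul_eq_zero, map_eq_zero, or_self] at d₁ d₂ d₃
    simp [d₁, d₂, d₃] at hne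
  have twist {a b : Ω} (hd : a * F a = b * F b) (hb : b = l * F a) : a = l * F l * F (F a) := by
    rcases eq_or_ne a 0 with rfl | ha
    · simp
    · refine mul_right_cancel₀ (hF0 ha) ?_
      rw [hd, hb, map_mul]
      ring
  obtain ⟨t, ht⟩ := IsAlgClosed.exists_pow_nat_eq l (Nat.sub_pos_of_lt hq)
  have ht0 : t ≠ 0 := by
    rintro rfl
    exact hl (by rw [← ht, zero_pow (Nat.sub_pos_of_lt hq).ne'])
  have hFt : F t = t * l := by
    rw [hF, ← ht, ← pow_succ', Nat.sub_add_cancel hq.le]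
  have fixed {a b : Ω} (hd : a * F a = b * F b) (hb : b = l * F a) : F (F (t * a)) = t * a := by
    conv_rhs => rw [twist hd hb]
    simp only [map_mul, hFt]
    ring
  refine ⟨t * a₁, t * a₂, t * a₃, ?_, fixed d₁ l₁, fixed d₂ l₂, fixed d₃ l₃, ?_, ?_⟩
  · simp only [ne_eq, mul_eq_zero, ht0, false_or]
    tauto
  · simp only [map_mul, hFt]
    rw [l₁, l₂, l₃] at hpl
    linear_combination t ^ 2 * hpl
  · linear_combination t * hau

lemma isUnit_of_dvd_binomials {K : Type*} [Field K] {a b : ℕ} (hab : a ≠ b)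
    {p : MvPolynomial (Fin 3) K}
    (h : ∀ i l, i ≠ l → p ∣ X i ^ a * X l ^ b - X i ^ b * X l ^ a) : IsUnit p := by
  have hne (i l : Fin 3) (hil : i ≠ l) :
      (X i ^ a * X l ^ b - X i ^ b * X l ^ a : MvPolynomial (Fin 3) K) ≠ 0 := by
    intro h0
    have h1 := congrArg (aeval fun t => if t = i then (Polynomial.X : Polynomial K) else 1) h0
    simp only [map_sub, map_mul, map_pow, aeval_X, if_pos, if_neg hil.symm, one_pow, mul_one,
      map_zero, sub_eq_zero] at h1
    exact hab (by simpa using congrArg Polynomial.natDegree h1)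
  have hp0 : p ≠ 0 := by
    rintro rfl
    exact hne 0 1 (by decide) (zero_dvd_iff.mp (h 0 1 (by decide)))
  have hdeg (t : Fin 3) : degreeOf t p = 0 := by
    obtain ⟨i, l, hil, hti, htl⟩ : ∃ i l : Fin 3, i ≠ l ∧ t ≠ i ∧ t ≠ l := by
      fin_cases t
      · exact ⟨1, 2, by decide⟩
      · exact ⟨0, 2, by decide⟩
      · exact ⟨0, 1, by decide⟩
    obtain ⟨r, hr⟩ := h i l hil
    have hr0 : r ≠ 0 := by
      rintro rfl
      exact hne i l hil (by rw [hr, mul_zero])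
    have hmon (m n : ℕ) : degreeOf t (X i ^ m * X l ^ n : MvPolynomial (Fin 3) K) = 0 := by
      rw [degreeOf_mul_X_pow_of_ne _ htl, ← one_mul (X i ^ m), degreeOf_mul_X_pow_of_ne _ hti,
        ← C_1, degreeOf_C]
    have hle := degreeOf_sub_le t (X i ^ a * X l ^ b : MvPolynomial (Fin 3) K) (X i ^ b * X l ^ a)
    rw [hr, degreeOf_mul_eq hp0 hr0, hmon, hmon] at hle
    omega
  have hC : p = C (coeff 0 p) := by
    rw [← totalDegree_eq_zero_iff_eq_C, totalDegree_eq_zero_iff]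
    intro m hm t
    have := degreeOf_le_iff.mp (hdeg t).le m hm
    omega
  rw [hC]
  refine (IsUnit.mk0 _ fun h0 => hp0 ?_).map C
  rw [hC, h0, C_0]

lemma isUnit_of_mul_self_dvd_phiJNum {K : Type} [Field K] {d : ℕ} (hd : 2 ≤ d)
    (hdK : (d : K) ≠ 0) {p : MvPolynomial (Fin 3) K} (h : p * p ∣ phiJNum K d) : IsUnit p := by
  refine isUnit_of_dvd_binomials (a := d - 1) (b := 0) (by omega) fun i l _ => ?_
  have hder (i : Fin 3) : p ∣ pderiv i (phiJNum K d) := by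
    obtain ⟨r, hr⟩ := h
    rw [hr, pderiv_mul, pderiv_mul]
    exact ⟨2 * pderiv i p * r + p * pderiv i r, by ring⟩
  have hval (i : Fin 3) : pderiv i (phiJNum K d) =
      C (d : K) * (X i ^ (d - 1) + (X 0 + X 1 + X 2) ^ (d - 1)) := by
    rw [phiJNum]
    fin_cases i <;> simp [pderiv_X] <;> ring
  have hsub := dvd_sub (hder i) (hder l)
  rw [hval, hval, ← mul_sub, add_sub_add_right_eq_sub] at hsub
  simpa using (((IsUnit.mk0 _ hdK).map C).dvd_mul_left).mp hsub

/-- The Dickson-type recursion expressing `r ^ 2 ^ k * s + r * s ^ 2 ^ k` in characteristic two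
through `T = r + s` and `N = r * s`. -/
def kasamiAux {R : Type*} [CommRing R] (T N : R) : ℕ → R
  | 0 => 0
  | k + 1 => T ^ 2 ^ k * kasamiAux T N k + N ^ 2 ^ k * T

/-- Up to scaling of the variables, the absolutely irreducible factors of the Kasami polynomial
`φ_d`, `d = 2 ^ (2 * k) - 2 ^ k + 1`. -/
def kasamiFactor {R : Type*} [CommRing R] (k : ℕ) (x y z : R) : R :=
  (x + y + z) ^ (2 ^ k + 1) + kasamiAux (x + y + z) (x * z) k + x ^ 2 ^ k * z + x * z ^ 2 ^ k

section CharTwo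

variable {R S : Type*} [CommRing R] [CommRing S]

lemma map_kasamiAux (f : R →+* S) (T N : R) (k : ℕ) :
    f (kasamiAux T N k) = kasamiAux (f T) (f N) k := by
  induction k with
  | zero => simp [kasamiAux]
  | succ k ih => simp [kasamiAux, ih]

lemma map_kasamiFactor (f : R →+* S) (k : ℕ) (x y z : R) :
    f (kasamiFactor k x y z) = kasamiFactor k (f x) (f y) (f z) := by
  simp [kasamiFactor, map_kasamiAux]

variable [CharP R 2]

lemma kasamiAux_add_mul (r s : R) (k : ℕ) :
    kasamiAux (r + s) (r * s) k = r ^ 2 ^ k * s + r * s ^ 2 ^ k := by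
  have h2 : (2 : R) = 0 := CharTwo.two_eq_zero
  induction k with
  | zero => simp [kasamiAux, CharTwo.add_self_eq_zero]
  | succ k ih =>
    rw [kasamiAux, ih, add_pow_char_pow, mul_pow, pow_succ 2 k, pow_mul, pow_mul]
    linear_combination (r ^ 2 ^ k * s ^ 2 ^ k * (r + s)) * h2

lemma kasamiFactor_zero (k : ℕ) (x z : R) : kasamiFactor k x 0 z = (x + z) ^ (2 ^ k + 1) := by
  have h2 : (2 : R) = 0 := CharTwo.two_eq_zero
  rw [kasamiFactor, add_zero, kasamiAux_add_mul]
  linear_combination (x ^ 2 ^ k * z + x * z ^ 2 ^ k) * h2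

lemma kasamiFactor_eq_zero_of_add_eq_zero (k : ℕ) {x y z : R} (h : x + y + z = 0) :
    kasamiFactor k (x ^ (2 ^ k + 1)) (y ^ (2 ^ k + 1)) (z ^ (2 ^ k + 1)) = 0 := by
  have h2 : (2 : R) = 0 := CharTwo.two_eq_zero
  obtain rfl : y = x + z := by linear_combination h - (x + z) * h2
  have hT : x ^ (2 ^ k + 1) + (x + z) ^ (2 ^ k + 1) + z ^ (2 ^ k + 1) =
      x ^ 2 ^ k * z + x * z ^ 2 ^ k := by
    rw [pow_succ (x + z), add_pow_char_pow, pow_succ, pow_succ]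
    linear_combination (x ^ 2 ^ k * x + z ^ 2 ^ k * z) * h2
  have hN : x ^ (2 ^ k + 1) * z ^ (2 ^ k + 1) = (x ^ 2 ^ k * z) * (x * z ^ 2 ^ k) := by ring
  rw [kasamiFactor, hT, hN, kasamiAux_add_mul, pow_succ (_ + _), add_pow_char_pow]
  simp only [mul_pow, pow_succ _ (2 ^ k)]
  generalize x ^ 2 ^ k = X
  generalize z ^ 2 ^ k = Z
  generalize X ^ 2 ^ k = X'
  generalize Z ^ 2 ^ k = Z'
  linear_combination (X' * Z * X * z + X' * Z * x * Z + X * X * Z' * z + X * x * Z * Z') * h2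

end CharTwo

lemma exists_dvd_kasamiFactor {K : Type} [Field K] [IsAlgClosed K] [CharP K 2] {k : ℕ}
    (hk : 1 ≤ k) {p : MvPolynomial (Fin 3) K} (hp : Prime p)
    (h : p ∣ phiJNum K (2 ^ (2 * k) - 2 ^ k + 1)) :
    ∃ c₁ c₂ c₃ : K, (c₁ ≠ 0 ∨ c₃ ≠ 0) ∧
      p ∣ kasamiFactor k (C c₁ * X 0) (C c₂ * X 1) (C c₃ * X 2) := by
  have hprime : (Ideal.span {p}).IsPrime := (Ideal.span_singleton_prime hp.ne_zero).mpr hp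
  let E := FractionRing (MvPolynomial (Fin 3) K ⧸ Ideal.span {p})
  let Ω := AlgebraicClosure E
  let ψ : MvPolynomial (Fin 3) K →+* Ω :=
    (algebraMap E Ω).comp ((algebraMap _ E).comp (Ideal.Quotient.mk (Ideal.span {p})))
  have hψ (g : MvPolynomial (Fin 3) K) : ψ g = 0 ↔ p ∣ g := by
    rw [RingHom.comp_apply, map_eq_zero_iff _ (algebraMap E Ω).injective, RingHom.comp_apply,
      map_eq_zero_iff _ (IsFractionRing.injective _ E), Ideal.Quotient.eq_zero_iff_mem,
      Ideal.mem_span_singleton]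
  have hcharp : CharP Ω 2 := charP_of_injective_ringHom (ψ.comp C).injective 2
  have h2 : (2 : Ω) = 0 := CharTwo.two_eq_zero
  set q := 2 ^ k with hq
  have hq1 : 1 < q := Nat.one_lt_two_pow (by omega)
  have hexp : (q + 1) * (2 ^ (2 * k) - q + 1) = q ^ 3 + 1 := by
    have h1 : 2 ^ (2 * k) = q * q := by rw [hq]; ring
    rw [h1]
    have h3 : q ≤ q * q := Nat.le_mul_self q
    zify [h3]
    ring
  have hroot (x : Ω) : ∃ u, u ^ (q + 1) = x := IsAlgClosed.exists_pow_nat_eq x (by omega)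
  choose u hu using fun i : Fin 3 => hroot (ψ (X i))
  obtain ⟨w, hw⟩ := hroot (ψ (X 0 + X 1 + X 2))
  let F : Ω →+* Ω := iterateFrobenius Ω 2 k
  have hF (x : Ω) : F x = x ^ q := iterateFrobenius_def 2 k x
  have hFFF (x : Ω) : x * F (F (F x)) = (x ^ (q + 1)) ^ (2 ^ (2 * k) - q + 1) := by
    rw [← pow_mul, hexp, hF, hF, hF]
    ring
  have hF1 (x : Ω) : x * F x = x ^ (q + 1) := by rw [hF]; ring
  obtain ⟨a₁, a₂, a₃, ha, ha₁, ha₂, ha₃, hsum, hrel⟩ :=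
    exists_hermitian_relation hq1 F hF (u₁ := u 0) (u₂ := u 1) (u₃ := u 2) (u₄ := w)
      (by
        rw [hF1, hF1, hF1, hF1, hw, hu, hu, hu, map_add, map_add]
        linear_combination (ψ (X 0) + ψ (X 1) + ψ (X 2)) * h2)
      (by
        rw [hFFF, hFFF, hFFF, hFFF, hw, hu, hu, hu]
        simpa [phiJNum] using (hψ _).mpr h)
      (by
        by_contra! hcon
        obtain ⟨h01, h02, h12⟩ := hcon
        refine hp.not_isUnit (isUnit_of_dvd_binomials (a := 1) (b := q ^ 2)
          (by nlinarith) fun i l hil => (hψ _).mp ?_)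
        have key : u i * F (F (u l)) = u l * F (F (u i)) := by
          fin_cases i <;> fin_cases l <;> first | exact absurd rfl hil | skip
          · exact sub_eq_zero.mp h01
          · exact sub_eq_zero.mp h02
          · exact (sub_eq_zero.mp h01).symm
          · exact sub_eq_zero.mp h12
          · exact (sub_eq_zero.mp h02).symm
          · exact (sub_eq_zero.mp h12).symm
        have key' := congrArg (· ^ (q + 1)) key
        simp only [hF] at key'
        rw [map_sub, map_mul, map_mul, map_pow, map_pow, map_pow, map_pow, ← hu i, ← hu l]
        linear_combination key')
  have hlift (a : Ω) (haF : F (F a) = a) : ∃ c : K, ψ (C c) = a ^ (q + 1) := by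
    have hroot' : (a ^ (q + 1)) ^ q = a ^ (q + 1) := by
      rw [hF, hF] at haF
      calc (a ^ (q + 1)) ^ q = (a ^ q) ^ q * a ^ q := by ring
        _ = a ^ (q + 1) := by rw [haF]; ring
    have hP0 : (Polynomial.X ^ q - Polynomial.X : Polynomial K) ≠ 0 :=
      FiniteField.X_pow_card_sub_X_ne_zero K hq1
    exact (IsAlgClosed.splits _).mem_range_of_isRoot hP0 (i := ψ.comp C) (by simp [hroot'])
  obtain ⟨c₁, hc₁⟩ := hlift a₁ ha₁
  obtain ⟨c₂, hc₂⟩ := hlift a₂ ha₂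
  obtain ⟨c₃, hc₃⟩ := hlift a₃ ha₃
  refine ⟨c₁, c₂, c₃, ?_, (hψ _).mp ?_⟩
  · by_contra! hcon
    rw [hcon.1, C_0, map_zero, eq_comm, pow_eq_zero_iff (by omega)] at hc₁
    rw [hcon.2, C_0, map_zero, eq_comm, pow_eq_zero_iff (by omega)] at hc₃
    rw [hc₁, hc₃, zero_mul, zero_add, add_zero, hF1, pow_eq_zero_iff (by omega)] at hsum
    simp [hc₁, hc₃, hsum] at ha
  · rw [map_kasamiFactor, map_mul, map_mul, map_mul, hc₁, hc₂, hc₃, ← hu, ← hu, ← hu, ← mul_pow,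
      ← mul_pow, ← mul_pow]
    exact kasamiFactor_eq_zero_of_add_eq_zero k hrel

lemma not_dvd_linear_pow_of_mul_eq {K : Type*} [Field K] [IsAlgClosed K] [CharP K 2] {j : ℕ}
    (hj : 4 ≤ j) (hjK : (j : K) ≠ 0) {h : Polynomial K}
    (hh : h * (Polynomial.X * (Polynomial.X + 1)) =
      Polynomial.X ^ j + 1 + (Polynomial.X + 1) ^ j) {c₁ c₃ : K} (hc : c₁ ≠ 0 ∨ c₃ ≠ 0) (m : ℕ) :
    ¬ h ∣ (Polynomial.C c₁ * Polynomial.X + Polynomial.C c₃) ^ m := by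
  intro hdvd
  have h2 : (2 : K) = 0 := CharTwo.two_eq_zero
  have hlin (β : K) (hβ : h.IsRoot β) : c₁ * β + c₃ = 0 := by
    have := hβ.dvd hdvd
    simp only [Polynomial.IsRoot, Polynomial.eval_pow] at this
    simpa using eq_zero_of_pow_eq_zero this
  have heval (β : K) : h.eval β * (β * (β + 1)) = β ^ j + 1 + (β + 1) ^ j := by
    simpa using congrArg (Polynomial.eval β) hh
  have hder (β : K) (hβ : β * (β + 1) = 0) : h.eval β = j * (β ^ (j - 1) + (β + 1) ^ (j - 1)) := by
    have := congrArg (fun p => Polynomial.eval β (Polynomial.derivative p)) hh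
    simp [Polynomial.derivative_pow, hβ] at this
    linear_combination this - h.eval β * β * h2
  have hdeg : h.degree ≠ 0 := by
    intro h0
    rw [Polynomial.eq_C_of_degree_eq_zero h0] at hh
    have := congrArg (Polynomial.coeff · (j - 1)) hh
    obtain ⟨i, rfl⟩ : ∃ i, j = i + 4 := ⟨j - 4, by omega⟩
    simp [mul_add, Polynomial.coeff_X_pow, Polynomial.coeff_X_add_one_pow, Polynomial.coeff_one,
      ← pow_two] at this
    exact hjK (by push_cast; linear_combination -this)
  obtain ⟨α, hα⟩ := IsAlgClosed.exists_root h hdeg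
  have h0 : α ≠ 0 := by
    rintro rfl
    have := hder 0 (by simp)
    rw [hα] at this
    simp [zero_pow (show j - 1 ≠ 0 by omega)] at this
    exact hjK this.symm
  have h1 : α + 1 ≠ 0 := by
    intro h1
    have := hder α (by simp [h1])
    rw [hα, h1, show α = 1 by linear_combination h1 - h2] at this
    simp [zero_pow (show j - 1 ≠ 0 by omega)] at this
    exact hjK this.symm
  have hα' : h.IsRoot (α ^ 2) := by
    have e1 := heval α
    rw [hα, zero_mul] at e1
    have e2 := heval (α ^ 2)
    have e3 : α ^ 2 + 1 = (α + 1) ^ 2 := by linear_combination -α * h2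
    rw [e3, ← pow_mul, ← pow_mul, mul_comm 2 j, pow_mul, pow_mul] at e2
    have e4 : (α ^ j) ^ 2 + 1 + ((α + 1) ^ j) ^ 2 = 0 := by
      generalize α ^ j = s at *
      generalize (α + 1) ^ j = t at *
      linear_combination -(s + 1 + t) * e1 - (s * t + s + t) * h2
    rw [e4] at e2
    exact (mul_eq_zero.mp e2).resolve_right (by positivity)
  have l1 := hlin _ hα
  have l2 := hlin _ hα'
  have hc1 : c₁ = 0 := by
    have : c₁ * (α * (α + 1)) = 0 := by linear_combination l2 - l1 + c₁ * α * h2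
    simpa [h0, h1] using this
  simp [hc1] at l1 hc
  exact hc l1

lemma odd_kasamiExponent {k : ℕ} (hk : 1 ≤ k) : Odd (2 ^ (2 * k) - 2 ^ k + 1) := by
  exact Even.add_one (.tsub (even_two.pow_of_ne_zero (by omega))
    (even_two.pow_of_ne_zero (by omega)))

lemma natCast_ne_zero_of_odd {K : Type*} [Field K] [CharP K 2] {j : ℕ} (hj : Odd j) :
    (j : K) ≠ 0 := by
  rw [CharTwo.natCast_eq_ite, if_neg (Nat.not_even_iff_odd.mpr hj)]
  exact one_ne_zero

lemma delta3_ne_zero (K : Type) [Field K] : delta3 K ≠ 0 := by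
  intro h0
  have h1 := congrArg (aeval ![1, 0, (Polynomial.X : Polynomial K)]) h0
  simp [delta3] at h1
  have h2 := congrArg (Polynomial.coeff · 1) h1
  simp [Polynomial.coeff_one] at h2

lemma isUnit_of_mul_self_dvd_kasami {K : Type} [Field K] [CharP K 2] {k : ℕ} (hk : 1 ≤ k)
    {p : MvPolynomial (Fin 3) K} (h : p * p ∣ phiJNum K (2 ^ (2 * k) - 2 ^ k + 1)) :
    IsUnit p := by
  refine isUnit_of_mul_self_dvd_phiJNum ?_ (natCast_ne_zero_of_odd (odd_kasamiExponent hk)) h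
  have : 2 ^ k < 2 ^ (2 * k) := Nat.pow_lt_pow_right (by omega) (by omega)
  omega

lemma not_dvd_of_delta3_mul_eq {K : Type} [Field K] [IsAlgClosed K] [CharP K 2] {j k : ℕ}
    (hj : 3 ≤ j) (hk : 1 ≤ k) {φj φd : MvPolynomial (Fin 3) K}
    (hφj : delta3 K * φj = phiJNum K j) (hirr : Irreducible φj)
    (hφd : delta3 K * φd = phiJNum K (2 ^ (2 * k) - 2 ^ k + 1)) : ¬ φj ∣ φd := by
  intro hdvd
  have h2 : (2 : MvPolynomial (Fin 3) K) = 0 := CharTwo.two_eq_zero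
  have hd : φj ∣ phiJNum K (2 ^ (2 * k) - 2 ^ k + 1) := hφd ▸ hdvd.mul_left _
  obtain ⟨m, rfl⟩ | hodd := Nat.even_or_odd j
  · have hsq : phiJNum K (m + m) = phiJNum K m * phiJNum K m := by
      simp only [phiJNum, pow_add]
      generalize (X 0 : MvPolynomial (Fin 3) K) ^ m = a
      generalize (X 1 : MvPolynomial (Fin 3) K) ^ m = b
      generalize (X 2 : MvPolynomial (Fin 3) K) ^ m = c
      generalize (X 0 + X 1 + X 2 : MvPolynomial (Fin 3) K) ^ m = d
      linear_combination -(a * b + a * c + a * d + b * c + b * d + c * d) * h2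
    have hdvd' : φj ∣ phiJNum K m * phiJNum K m := hsq ▸ hφj ▸ dvd_mul_left _ _
    obtain ⟨r, hr⟩ := or_self_iff.mp (hirr.prime.dvd_or_dvd hdvd')
    have hδ : delta3 K = φj * (r * r) := by
      refine mul_right_cancel₀ hirr.ne_zero ?_
      rw [hφj, hsq, hr]
      ring
    refine hirr.not_isUnit (isUnit_of_mul_self_dvd_kasami hk ?_)
    rw [← hφd]
    exact mul_dvd_mul (hδ ▸ dvd_mul_right _ _) hdvd
  · have hj3 : j ≠ 3 := by
      rintro rfl
      refine hirr.not_isUnit (IsUnit.of_mul_eq_one 1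
        (mul_left_cancel₀ (delta3_ne_zero K) ?_))
      rw [mul_one, mul_one, hφj, phiJNum, delta3]
      generalize (X 0 : MvPolynomial (Fin 3) K) = a
      generalize (X 1 : MvPolynomial (Fin 3) K) = b
      generalize (X 2 : MvPolynomial (Fin 3) K) = c
      linear_combination (a ^ 3 + b ^ 3 + c ^ 3 + a ^ 2 * b + a * b ^ 2 + a ^ 2 * c + a * c ^ 2 +
        b ^ 2 * c + b * c ^ 2 + 2 * a * b * c) * h2
    obtain ⟨c₁, c₂, c₃, hc, hfac⟩ := exists_dvd_kasamiFactor hk hirr.prime hd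
    let ε : MvPolynomial (Fin 3) K →ₐ[K] Polynomial K := aeval ![Polynomial.X, 0, 1]
    refine not_dvd_linear_pow_of_mul_eq (h := ε φj) (by omega) (natCast_ne_zero_of_odd hodd) ?_
      hc (2 ^ k + 1) ?_
    · have := congrArg ε hφj
      simp [ε, delta3, phiJNum, zero_pow (show j ≠ 0 by omega)] at this
      linear_combination this
    · have := map_dvd ε hfac
      rw [← AlgHom.coe_toRingHom, map_kasamiFactor] at this
      simp [ε, kasamiFactor_zero] at this
      exact this

lemma isHomogeneous_delta3 (K : Type) [CommRing K] : (delta3 K).IsHomogeneous 3 :=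
  (((isHomogeneous_X K 0).add (isHomogeneous_X K 1)).mul
    ((isHomogeneous_X K 0).add (isHomogeneous_X K 2))).mul
    ((isHomogeneous_X K 1).add (isHomogeneous_X K 2))

lemma isHomogeneous_phiJNum (K : Type) [CommRing K] (j : ℕ) : (phiJNum K j).IsHomogeneous j := by
  have hX (i : Fin 3) : (X i ^ j : MvPolynomial (Fin 3) K).IsHomogeneous j :=
    isHomogeneous_X_pow i j
  have hS : (X 0 + X 1 + X 2 : MvPolynomial (Fin 3) K).IsHomogeneous 1 :=
    ((isHomogeneous_X K 0).add (isHomogeneous_X K 1)).add (isHomogeneous_X K 2)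
  exact (((hX 0).add (hX 1)).add (hX 2)).add (by simpa using hS.pow j)

lemma homogeneousComponent_phiNum {K : Type} [CommRing K] (f : Polynomial K) (n : ℕ) :
    homogeneousComponent n (phiNum f) = C (f.coeff n) * phiJNum K n := by
  induction f using Polynomial.induction_on' with
  | add p q hp hq =>
    have : phiNum (p + q) = phiNum p + phiNum q := by simp only [phiNum, map_add]; ring
    rw [this, map_add, hp, hq, Polynomial.coeff_add, C_add, add_mul]
  | monomial m a =>
    have : phiNum (Polynomial.monomial m a) = C a * phiJNum K m := by
      simp only [phiNum, phiJNum, Polynomial.aeval_monomial, algebraMap_eq]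
      ring
    rw [this, homogeneousComponent_C_mul,
      homogeneousComponent_of_mem ((mem_homogeneousSubmodule _ _).mpr (isHomogeneous_phiJNum K m)),
      Polynomial.coeff_monomial]
    split_ifs with h1 h2 h2
    · rw [h1]
    · exact absurd h1.symm h2
    · exact absurd h2.symm h1
    · simp

section Map

variable {K L : Type} [CommRing K] [CommRing L] (σ : K →+* L)

lemma map_delta3 : map σ (delta3 K) = delta3 L := by simp [delta3]

lemma map_phiJNum (j : ℕ) : map σ (phiJNum K j) = phiJNum L j := by simp [phiJNum]

lemma map_phiNum (f : Polynomial K) : map σ (phiNum f) = phiNum (f.map σ) := by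
  simp [phiNum, Polynomial.aeval_def, Polynomial.hom_eval₂, Polynomial.eval₂_map]

end Map

lemma irreducible_of_delta3_mul_eq_phiNum {K : Type} [Field K] [IsAlgClosed K] [CharP K 2]
    {k : ℕ} (hk : 1 ≤ k) {g : Polynomial K}
    (hg : g.natDegree ≤ 2 ^ (2 * k - 1) - 2 ^ (k - 1) + 1) {j : ℕ} (hj : 3 ≤ j)
    (hcoeff : g.coeff j ≠ 0) {φj : MvPolynomial (Fin 3) K} (hφj : delta3 K * φj = phiJNum K j)
    (hirr : Irreducible φj) {φ : MvPolynomial (Fin 3) K}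
    (hφ : delta3 K * φ = phiNum (Polynomial.X ^ (2 ^ (2 * k) - 2 ^ k + 1) + g)) :
    Irreducible φ := by
  have hjB : j ≤ 2 ^ (2 * k - 1) - 2 ^ (k - 1) + 1 :=
    (Polynomial.le_natDegree_of_ne_zero hcoeff).trans hg
  have hBd : 2 * (2 ^ (2 * k - 1) - 2 ^ (k - 1) + 1) = 2 ^ (2 * k) - 2 ^ k + 2 := by
    obtain ⟨i, rfl⟩ : ∃ i, k = i + 1 := ⟨k - 1, by omega⟩
    rw [show 2 * (i + 1) - 1 = 2 * i + 1 by omega, show 2 * (i + 1) = 2 * i + 1 + 1 by omega,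
      Nat.add_sub_cancel, pow_succ 2 (2 * i + 1), pow_succ 2 i]
    omega
  have hdiv {p : MvPolynomial (Fin 3) K} (h : p * p ∣ phiJNum K (2 ^ (2 * k) - 2 ^ k + 1)) :
    IsUnit p := isUnit_of_mul_self_dvd_kasami hk h
  have hndvd {φd : MvPolynomial (Fin 3) K}
    (hφd : delta3 K * φd = phiJNum K (2 ^ (2 * k) - 2 ^ k + 1)) : ¬ φj ∣ φd :=
    not_dvd_of_delta3_mul_eq hj hk hφj hirr hφd
  generalize 2 ^ (2 * k - 1) - 2 ^ (k - 1) + 1 = B at hg hjB hBd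
  obtain ⟨N, hN⟩ : ∃ N, 2 ^ (2 * k) - 2 ^ k + 1 = N + 3 :=
    ⟨_, (Nat.sub_add_cancel (by omega)).symm⟩
  rw [hN] at hφ hdiv hndvd
  have hδ := delta3_ne_zero K
  have hcomp (r : ℕ) : delta3 K * homogeneousComponent r φ =
      C ((Polynomial.X ^ (N + 3) + g).coeff (r + 3)) * phiJNum K (r + 3) := by
    rw [← homogeneousComponent_add_mul_of_isHomogeneous (isHomogeneous_delta3 K), hφ, add_comm 3,
      homogeneousComponent_phiNum]
  have hgap (r : ℕ) (hr : B < r + 3) (hrN : r ≠ N) : homogeneousComponent r φ = 0 := by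
    have := hcomp r
    rw [Polynomial.coeff_add, Polynomial.coeff_X_pow, if_neg (by omega),
      Polynomial.coeff_eq_zero_of_natDegree_lt (hg.trans_lt hr), add_zero, C_0, zero_mul] at this
    exact (mul_eq_zero.mp this).resolve_left hδ
  have htop : delta3 K * homogeneousComponent N φ = phiJNum K (N + 3) := by
    rw [hcomp, Polynomial.coeff_add, Polynomial.coeff_X_pow, if_pos rfl,
      Polynomial.coeff_eq_zero_of_natDegree_lt (by omega), add_zero, C_1, one_mul]
  have hmid : homogeneousComponent (j - 3) φ = C (g.coeff j) * φj := by
    refine mul_left_cancel₀ hδ ?_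
    rw [hcomp, Nat.sub_add_cancel hj, Polynomial.coeff_add, Polynomial.coeff_X_pow,
      if_neg (by omega), zero_add, mul_left_comm, hφj]
  have htop0 : homogeneousComponent N φ ≠ 0 := fun h0 => hndvd htop (h0 ▸ dvd_zero _)
  have hφ0 : φ ≠ 0 := by
    rintro rfl
    exact htop0 (map_zero _)
  have hdeg : φ.totalDegree = N := by
    by_contra hne
    have hle : N ≤ φ.totalDegree := by
      by_contra! hlt
      exact htop0 (homogeneousComponent_eq_zero N φ hlt)
    exact homogeneousComponent_totalDegree_ne_zero hφ0 (hgap _ (by omega) hne)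
  have key (P Q : MvPolynomial (Fin 3) K) (hPQ : φ = P * Q) (hle : Q.totalDegree ≤ P.totalDegree) :
      IsUnit Q := by
    have hP0 : P ≠ 0 := left_ne_zero_of_mul (hPQ ▸ hφ0)
    have hQ0 : Q ≠ 0 := right_ne_zero_of_mul (hPQ ▸ hφ0)
    have hsum : P.totalDegree + Q.totalDegree = N := by
      rw [← hdeg, hPQ, totalDegree_mul_of_isDomain hP0 hQ0]
    by_contra hQu
    have hQpos : 0 < Q.totalDegree := by
      by_contra! h0
      have hQC := totalDegree_eq_zero_iff_eq_C.mp (Nat.le_zero.mp h0)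
      refine hQu (hQC ▸ (IsUnit.mk0 _ fun h => hQ0 ?_).map C)
      rw [hQC, h, C_0]
    have htopPQ : homogeneousComponent N φ = homogeneousComponent P.totalDegree P *
        homogeneousComponent Q.totalDegree Q := by
      rw [← hsum, hPQ, homogeneousComponent_totalDegree_mul]
    have hcop : IsRelPrime (homogeneousComponent P.totalDegree P)
        (homogeneousComponent Q.totalDegree Q) := fun e heP heQ => by
      refine hdiv (htop ▸ htopPQ ▸ (mul_dvd_mul heP heQ).mul_left _)
    have hQ := isHomogeneous_of_homogeneousComponent_mul_eq_zero hQpos hle hcop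
      fun r hr hr' => hPQ ▸ hgap r (by omega) (by omega)
    have hQdvd (r : ℕ) : Q ∣ homogeneousComponent r φ :=
      hQ.dvd_homogeneousComponent (hPQ ▸ dvd_mul_left _ _) r
    have hQφj : Q ∣ φj := by
      have := hQdvd (j - 3)
      rwa [hmid, ((IsUnit.mk0 _ hcoeff).map C).dvd_mul_left] at this
    exact hndvd htop (((hirr.dvd_iff.mp hQφj).resolve_left hQu).dvd.trans (hQdvd N))
  refine ⟨fun hu => ?_, fun P Q hPQ => ?_⟩
  · obtain ⟨c, -, hc⟩ := MvPolynomial.isUnit_iff_eq_C_of_isReduced.mp hu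
    rw [hc, totalDegree_C] at hdeg
    omega
  · obtain h | h := le_total Q.totalDegree P.totalDegree
    · exact Or.inr (key P Q hPQ h)
    · exact Or.inl (key Q P (hPQ.trans (mul_comm P Q)) h)

/-- Let `L = F_q`, `q = 2^n`, and `f(x) = x^{2^{2k}-2^k+1} + g(x)` with
`deg g ≤ 2^{2k-1} - 2^{k-1} + 1`. If there is `j ≥ 3` with `g.coeff j ≠ 0` such that
`φ_j` is absolutely irreducible, then `φ` is absolutely irreducible. -/
theorem kasami_plus_small_perturbation_abs_irred {n : ℕ} (hn : 0 < n) (L : Type)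
    [Field L] [Fintype L] (hcard : Fintype.card L = 2 ^ n)
    (k : ℕ) (hk : 1 ≤ k) (g : Polynomial L)
    (hg : g.natDegree ≤ 2 ^ (2 * k - 1) - 2 ^ (k - 1) + 1)
    (f : Polynomial L) (hf : f = Polynomial.X ^ (2 ^ (2 * k) - 2 ^ k + 1) + g)
    (j : ℕ) (hj3 : 3 ≤ j) (hcoeff : g.coeff j ≠ 0)
    (φj : MvPolynomial (Fin 3) L) (hφj : delta3 L * φj = phiJNum L j)
    (hφj_irr : AbsolutelyIrreducible φj)
    (φ : MvPolynomial (Fin 3) L) (hφ : delta3 L * φ = phiNum f) :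
    AbsolutelyIrreducible φ := by
  have : CharP L 2 := charP_of_card_eq_prime_pow hcard
  have : CharP (AlgebraicClosure L) 2 :=
    charP_of_injective_algebraMap (algebraMap L (AlgebraicClosure L)).injective 2
  refine irreducible_of_delta3_mul_eq_phiNum (g := g.map (algebraMap L (AlgebraicClosure L))) hk
    (Polynomial.natDegree_map_le.trans hg) hj3 ?_ ?_ hφj_irr ?_
  · rw [Polynomial.coeff_map]
    exact (map_ne_zero _).mpr hcoeff
  · rw [← map_delta3 (algebraMap L _), ← map_mul, hφj, map_phiJNum]
  · rw [← map_delta3 (algebraMap L _), ← map_mul, hφ, map_phiNum, hf, Polynomial.map_add,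
      Polynomial.map_pow, Polynomial.map_X]
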